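/- Fix 0<c<∞, an integer d≥3, and an integer K≥2. There exist ε>0 and δ>0 depending only on c, d, K such that for all n sufficiently large, the coalescence process on Λ(L,d) with k initial particles and moving rate q=cd/n² satisfies P[τ_col < εn³ | W_0 = w] ≤ 1−δ uniformly over all 2 ≤ k ≤ K and all initial configurations w∈Ω_k (i.e. k occupied sites, no two of them adjacent). -/

import Mathlib

open scoped Classical
open Finset

noncomputable section

/-- The number of particles (vertices labelled `1`) of a configuration. -/
def numParticles {V : Type*} [Fintype V] (x : V → Bool) : ℕ :=
  (Finset.univ.filter fun v => x v = true).card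

/-- One-step transition kernel of the kinetically constrained Ising process (KCIP)
on the graph `G` with density parameter `p`: a uniformly chosen vertex `v` is updated,
and its label is resampled (to `1` with probability `p`, to `0` otherwise) iff `v` has at
least one neighbour labelled `1`. -/
def kcipKernel {V : Type*} [Fintype V] (G : SimpleGraph V) (p : ℝ) (x y : V → Bool) : ℝ :=
  ((Fintype.card V : ℝ))⁻¹ * ∑ v : V,
    (if ∀ w, w ≠ v → y w = x w then
      (if ∃ u, G.Adj u v ∧ x u = true then (if y v = true then p else 1 - p)
       else (if y v = x v then 1 else 0))
     else 0)

/-- Probability that the Markov chain with kernel `K` started at `x` produces a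
trajectory `(X_0, …, X_T)` lying in the event `A`. -/
def trajProb {Ω : Type*} [Fintype Ω] (K : Ω → Ω → ℝ) (x : Ω) (T : ℕ)
    (A : (Fin (T + 1) → Ω) → Prop) : ℝ :=
  ∑ ω : Fin (T + 1) → Ω,
    if ω 0 = x ∧ A ω then ∏ i : Fin T, K (ω i.castSucc) (ω i.succ) else 0

/-- Expectation of a functional `f` of the trajectory `(X_0, …, X_T)` of the Markov chain
with kernel `K` started at `x`. -/
def trajExp {Ω : Type*} [Fintype Ω] (K : Ω → Ω → ℝ) (x : Ω) (T : ℕ)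
    (f : (Fin (T + 1) → Ω) → ℝ) : ℝ :=
  ∑ ω : Fin (T + 1) → Ω,
    (if ω 0 = x then ∏ i : Fin T, K (ω i.castSucc) (ω i.succ) else 0) * f ω

/-- The `d`-dimensional discrete torus `Z_L^d`: vertices are `Fin d → ZMod L`, with an edge
between `u` and `v` iff `u - v = ± e_i` for some coordinate vector `e_i`. -/
def torusGraph (L d : ℕ) : SimpleGraph (Fin d → ZMod L) :=
  SimpleGraph.fromRel fun u v => ∃ i : Fin d, v = u + fun j => if j = i then (1 : ZMod L) else 0

/-- `Ω_k`: configurations with exactly `k` particles, no two of which are adjacent. -/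
def OmegaK {V : Type*} [Fintype V] (G : SimpleGraph V) (k : ℕ) : Set (V → Bool) :=
  {x | numParticles x = k ∧ ∀ u v, G.Adj u v → ¬(x u = true ∧ x v = true)}

/-- One-step kernel of the coalescence process with moving rate `q` on the graph `G`, recorded
through the indicator of occupied sites: with probability `q·|O|`, a uniformly chosen occupied
site `v` sends all its particles to a uniformly chosen neighbour `w`. -/
def coalKernel {V : Type*} [Fintype V] [DecidableEq V] (G : SimpleGraph V) (q : ℝ)
    (x y : V → Bool) : ℝ :=
  (if y = x then 1 - ∑ v : V, (if x v = true then q else 0) else 0) +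
  ∑ v : V, ∑ w : V,
    (if x v = true ∧ G.Adj v w ∧ y = Function.update (Function.update x v false) w true then
      q / (G.degree v) else 0)

/-- Transition function, started at the origin, of the lazy simple random walk on the torus
`(Z / m)^d`. -/
def heat {d m : ℕ} : ℕ → (Fin d → ZMod m) → ℝ
  | 0, z => if z = 0 then 1 else 0
  | t + 1, z => heat t z / 2 +
      (∑ i : Fin d, (heat t (z + Pi.single i 1) + heat t (z - Pi.single i 1))) / (4 * d)

section Heat

variable {d m : ℕ}

lemma heat_nonneg (t : ℕ) (z : Fin d → ZMod m) : 0 ≤ heat t z := by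
  induction t generalizing z with
  | zero => simp only [heat]; split_ifs <;> norm_num
  | succ t ih =>
    simp only [heat]
    have h1 := ih z
    have h2 : 0 ≤ ∑ i : Fin d, (heat t (z + Pi.single i 1) + heat t (z - Pi.single i 1)) :=
      Finset.sum_nonneg fun i _ => add_nonneg (ih _) (ih _)
    positivity

lemma heat_neg (t : ℕ) (z : Fin d → ZMod m) : heat t (-z) = heat t z := by
  induction t generalizing z with
  | zero => simp only [heat, neg_eq_zero]
  | succ t ih =>
    simp only [heat, ih]
    congr 2
    refine Finset.sum_congr rfl fun i _ => ?_
    rw [← ih (-z + Pi.single i 1), ← ih (-z - Pi.single i 1), add_comm]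
    congr 2 <;> abel

/-- After `t` steps, no coordinate has moved by more than `t`. -/
lemma exists_int_of_heat_ne_zero (t : ℕ) (z : Fin d → ZMod m) (hz : heat t z ≠ 0) (j : Fin d) :
    ∃ a : ℤ, |a| ≤ t ∧ z j = a := by
  induction t generalizing z with
  | zero =>
    refine ⟨0, by simp, ?_⟩
    by_contra h
    refine hz ?_
    simp only [heat]
    rw [if_neg]
    rintro rfl
    simp at h
  | succ t ih =>
    by_cases h0 : heat t z = 0
    · have h1 : ∃ i : Fin d, heat t (z + Pi.single i 1) + heat t (z - Pi.single i 1) ≠ 0 := by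
        by_contra! h
        exact hz (by simp [heat, h0, h])
      obtain ⟨i, hi⟩ := h1
      have key : ∀ s : ℤ, |s| ≤ 1 → heat t (z + Pi.single i (s : ZMod m)) ≠ 0 →
          ∃ a : ℤ, |a| ≤ ((t + 1 : ℕ) : ℤ) ∧ z j = a := by
        intro s hs h
        obtain ⟨a, ha, haz⟩ := ih _ h
        rw [abs_le] at ha hs
        by_cases hij : j = i
        · subst hij
          refine ⟨a - s, abs_le.2 ⟨by push_cast; omega, by push_cast; omega⟩, ?_⟩
          simp only [Pi.add_apply, Pi.single_eq_same] at haz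
          push_cast
          rw [← haz]; ring
        · refine ⟨a, abs_le.2 ⟨by push_cast; omega, by push_cast; omega⟩, ?_⟩
          simpa [Pi.single_eq_of_ne hij] using haz
      by_cases hp : heat t (z + Pi.single i 1) = 0
      · refine key (-1) (by simp) ?_
        rw [hp, zero_add, sub_eq_add_neg, ← Pi.single_neg] at hi
        simpa using hi
      · exact key 1 (by simp) (by simpa using hp)
    · obtain ⟨a, ha, haz⟩ := ih z h0
      exact ⟨a, by push_cast; linarith, haz⟩

/-- The cosine of the angle attached to a frequency `a`. -/
def freqCos (a : ZMod m) : ℝ := Real.cos (2 * Real.pi * a.valMinAbs / m)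

/-- The eigenvalue of the lazy walk for the frequency `ξ`. -/
def lazyEigenvalue (ξ : Fin d → ZMod m) : ℝ := 1 / 2 + (∑ i, freqCos (ξ i)) / (2 * d)

lemma lazyEigenvalue_nonneg (ξ : Fin d → ZMod m) : 0 ≤ lazyEigenvalue ξ := by
  rcases Nat.eq_zero_or_pos d with rfl | hd
  · simp [lazyEigenvalue]
  have hd' : (0 : ℝ) < d := by exact_mod_cast hd
  have h : -(d : ℝ) ≤ ∑ i, freqCos (ξ i) := by
    have := Finset.sum_le_sum (s := Finset.univ) (f := fun _ : Fin d => (-1 : ℝ))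
      (g := fun i => freqCos (ξ i)) fun i _ => Real.neg_one_le_cos _
    simpa using this
  have h2 : -(1 / 2 : ℝ) ≤ (∑ i, freqCos (ξ i)) / (2 * d) := by
    rw [le_div_iff₀ (by positivity)]
    linarith
  rw [lazyEigenvalue]
  linarith

/-- The truncated Green function of the lazy walk on the torus. -/
def green (z : Fin d → ZMod m) : ℝ := ∑ t ∈ Finset.range (m ^ 2), heat t z

lemma green_nonneg (z : Fin d → ZMod m) : 0 ≤ green z :=
  Finset.sum_nonneg fun t _ => heat_nonneg t z

lemma green_neg (z : Fin d → ZMod m) : green (-z) = green z :=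
  Finset.sum_congr rfl fun t _ => heat_neg t z

lemma summable_one_div_sqrt_pow {d : ℕ} (hd : 3 ≤ d) : Summable fun t : ℕ => 1 / (√(t : ℝ)) ^ d := by
  have h : Summable fun t : ℕ => 1 / (t : ℝ) ^ ((d : ℝ) / 2) := by
    rw [Real.summable_one_div_nat_rpow]
    have : (3 : ℝ) ≤ d := by exact_mod_cast hd
    linarith
  refine h.congr fun t => ?_
  rw [Real.sqrt_eq_rpow, ← Real.rpow_natCast, ← Real.rpow_mul (Nat.cast_nonneg t)]
  congr 2
  ring

lemma sum_green_neighbors (hd : d ≠ 0) {z : Fin d → ZMod m} (hz : z ≠ 0) :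
    ∑ i : Fin d, (green (z + Pi.single i 1) + green (z - Pi.single i 1)) =
      2 * d * green z + 4 * d * heat (m ^ 2) z := by
  have hd' : (d : ℝ) ≠ 0 := by exact_mod_cast hd
  have h : ∀ t, ∑ i : Fin d, (heat t (z + Pi.single i 1) + heat t (z - Pi.single i 1)) =
      4 * d * (heat (t + 1) z - heat t z) + 2 * d * heat t z := by
    intro t
    simp only [heat]
    field_simp
    ring
  simp only [green, ← Finset.sum_add_distrib]
  rw [Finset.sum_comm]
  simp only [h]
  rw [Finset.sum_add_distrib, ← Finset.mul_sum, ← Finset.mul_sum, Finset.sum_range_sub (fun t => heat t z)]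
  simp only [heat, if_neg hz]
  ring

variable [NeZero m]

lemma stdAddChar_add_neg (a : ZMod m) :
    ZMod.stdAddChar a + ZMod.stdAddChar (-a) = 2 * ((freqCos a : ℝ) : ℂ) := by
  have h1 : ZMod.stdAddChar a = Complex.exp (2 * Real.pi * Complex.I * a.valMinAbs / m) := by
    rw [← ZMod.stdAddChar_coe, ZMod.coe_valMinAbs]
  have h2 : ZMod.stdAddChar (-a) = Complex.exp (-(2 * Real.pi * Complex.I * a.valMinAbs / m)) := by
    rw [AddChar.map_neg_eq_inv, h1, Complex.exp_neg]
  rw [h1, h2, freqCos]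
  push_cast
  rw [Complex.cos, mul_div_cancel₀ _ two_ne_zero]
  congr 2 <;> ring

/-- The character of the torus with frequency `ξ`. -/
def torusChar (ξ z : Fin d → ZMod m) : ℂ := ∏ i, ZMod.stdAddChar (ξ i * z i)

lemma torusChar_add_single (ξ z : Fin d → ZMod m) (i : Fin d) (s : ZMod m) :
    torusChar ξ (z + Pi.single i s) = torusChar ξ z * ZMod.stdAddChar (ξ i * s) := by
  simp only [torusChar, Pi.add_apply, mul_add, AddChar.map_add_eq_mul, Finset.prod_mul_distrib]
  congr 1
  rw [Finset.prod_eq_single i]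
  · simp
  · intro j _ hj
    simp [Pi.single_eq_of_ne hj]
  · simp

lemma norm_torusChar (ξ z : Fin d → ZMod m) : ‖torusChar ξ z‖ = 1 := by
  simp [torusChar, norm_prod, AddChar.norm_apply]

lemma sum_torusChar (z : Fin d → ZMod m) :
    ∑ ξ, torusChar ξ z = if z = 0 then (m : ℂ) ^ d else 0 := by
  have h := Finset.sum_prod_piFinset (ι := Fin d) (Finset.univ : Finset (ZMod m))
    (fun i a => (ZMod.stdAddChar (a * z i) : ℂ))
  rw [Fintype.piFinset_univ] at h
  simp only [torusChar]
  rw [h]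
  simp only [AddChar.sum_mulShift _ (ZMod.isPrimitive_stdAddChar m)]
  split_ifs with hz
  · simp [hz, ZMod.card]
  · obtain ⟨i, hi⟩ := Function.ne_iff.1 hz
    refine Finset.prod_eq_zero (Finset.mem_univ i) ?_
    rw [if_neg (by simpa using hi)]
    simp

lemma heat_eq_sum_torusChar (hd : d ≠ 0) (t : ℕ) (z : Fin d → ZMod m) :
    (heat t z : ℂ) = ((m : ℂ) ^ d)⁻¹ * ∑ ξ, (lazyEigenvalue ξ : ℂ) ^ t * torusChar ξ z := by
  have hm : (m : ℂ) ≠ 0 := by exact_mod_cast NeZero.ne m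
  have hd' : (d : ℂ) ≠ 0 := by exact_mod_cast hd
  induction t generalizing z with
  | zero =>
    simp only [heat, pow_zero, one_mul, sum_torusChar]
    split_ifs
    · rw [inv_mul_cancel₀ (pow_ne_zero _ hm)]; simp
    · simp
  | succ t ih =>
    have hstep : ∀ ξ : Fin d → ZMod m,
        ∑ i, (torusChar ξ (z + Pi.single i 1) + torusChar ξ (z - Pi.single i 1)) =
          torusChar ξ z * (2 * ∑ i, (freqCos (ξ i) : ℂ)) := by
      intro ξ
      rw [Finset.mul_sum, Finset.mul_sum]
      refine Finset.sum_congr rfl fun i _ => ?_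
      rw [sub_eq_add_neg, ← Pi.single_neg, torusChar_add_single, torusChar_add_single,
        ← stdAddChar_add_neg, mul_one, mul_neg_one]
      ring
    simp only [heat]
    push_cast
    simp only [ih]
    have hsum : ∑ i : Fin d, (((m : ℂ) ^ d)⁻¹ *
          ∑ ξ, (lazyEigenvalue ξ : ℂ) ^ t * torusChar ξ (z + Pi.single i 1) +
        ((m : ℂ) ^ d)⁻¹ * ∑ ξ, (lazyEigenvalue ξ : ℂ) ^ t * torusChar ξ (z - Pi.single i 1)) =
        ((m : ℂ) ^ d)⁻¹ * ∑ ξ, (lazyEigenvalue ξ : ℂ) ^ t *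
          (torusChar ξ z * (2 * ∑ i, (freqCos (ξ i) : ℂ))) := by
      simp only [← mul_add, ← Finset.sum_add_distrib, ← Finset.mul_sum]
      congr 1
      rw [Finset.sum_comm]
      refine Finset.sum_congr rfl fun ξ _ => ?_
      rw [← Finset.mul_sum, hstep]
    rw [hsum, mul_div_assoc, mul_div_assoc, ← mul_add, Finset.sum_div, Finset.sum_div,
      ← Finset.sum_add_distrib]
    congr 1
    refine Finset.sum_congr rfl fun ξ _ => ?_
    rw [pow_succ]
    have : (lazyEigenvalue ξ : ℂ) = 1 / 2 + (∑ i, (freqCos (ξ i) : ℂ)) / (2 * d) := by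
      simp [lazyEigenvalue]
    rw [this]
    field_simp
    ring

lemma freqCos_le (a : ZMod m) : freqCos a ≤ 1 - 8 * (a.valMinAbs : ℝ) ^ 2 / m ^ 2 := by
  have hm : (0 : ℝ) < m := by exact_mod_cast NeZero.pos m
  have hmem := a.valMinAbs_mem_Ioc
  have h1 : -(m : ℝ) < a.valMinAbs * 2 := by exact_mod_cast hmem.1
  have h2 : (a.valMinAbs : ℝ) * 2 ≤ m := by exact_mod_cast hmem.2
  have hpi := Real.pi_pos
  have habs : |2 * Real.pi * a.valMinAbs / m| ≤ Real.pi := by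
    rw [abs_le, le_div_iff₀ hm, div_le_iff₀ hm]
    constructor <;> nlinarith
  refine (Real.cos_le_one_sub_mul_cos_sq habs).trans (le_of_eq ?_)
  field_simp
  ring

lemma lazyEigenvalue_le (hd : d ≠ 0) (ξ : Fin d → ZMod m) :
    lazyEigenvalue ξ ≤ ∏ i, Real.exp (-(4 * ((ξ i).valMinAbs : ℝ) ^ 2 / (d * m ^ 2))) := by
  have hd' : (0 : ℝ) < d := by exact_mod_cast Nat.pos_of_ne_zero hd
  have hm : (0 : ℝ) < m := by exact_mod_cast NeZero.pos m
  rw [← Real.exp_sum]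
  refine le_trans ?_ (Real.add_one_le_exp _)
  have h : ∑ i, freqCos (ξ i) ≤ ∑ i, (1 - 8 * ((ξ i).valMinAbs : ℝ) ^ 2 / m ^ 2) :=
    Finset.sum_le_sum fun i _ => freqCos_le _
  have h2 : lazyEigenvalue ξ ≤
      1 / 2 + (∑ i, (1 - 8 * ((ξ i).valMinAbs : ℝ) ^ 2 / m ^ 2)) / (2 * d) := by
    rw [lazyEigenvalue]; gcongr
  refine h2.trans (le_of_eq ?_)
  rw [Finset.sum_sub_distrib, Finset.sum_neg_distrib, ← Finset.sum_div, ← Finset.sum_div,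
    ← Finset.mul_sum, ← Finset.mul_sum]
  simp
  field_simp
  ring

lemma heat_le_pow (hd : d ≠ 0) (t : ℕ) (z : Fin d → ZMod m) :
    heat t z ≤ ((∑ a : ZMod m, Real.exp (-(4 * (a.valMinAbs : ℝ) ^ 2 / (d * m ^ 2))) ^ t) / m) ^ d := by
  have hm : (0 : ℝ) < m := by exact_mod_cast NeZero.pos m
  have h1 : ‖(heat t z : ℂ)‖ ≤ ((m : ℝ) ^ d)⁻¹ * ∑ ξ : Fin d → ZMod m, lazyEigenvalue ξ ^ t := by
    rw [heat_eq_sum_torusChar hd, norm_mul]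
    have : ‖((m : ℂ) ^ d)⁻¹‖ = ((m : ℝ) ^ d)⁻¹ := by simp
    rw [this]
    gcongr
    refine (norm_sum_le _ _).trans (Finset.sum_le_sum fun ξ _ => ?_)
    rw [norm_mul, norm_torusChar, mul_one, norm_pow, Complex.norm_real, Real.norm_eq_abs,
      abs_of_nonneg (lazyEigenvalue_nonneg ξ)]
  rw [Complex.norm_real, Real.norm_eq_abs, abs_of_nonneg (heat_nonneg t z)] at h1
  refine h1.trans ?_
  rw [div_pow, div_eq_inv_mul]
  gcongr
  have h := Finset.sum_prod_piFinset (ι := Fin d) (Finset.univ : Finset (ZMod m))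
    (fun _ a => Real.exp (-(4 * (a.valMinAbs : ℝ) ^ 2 / (d * m ^ 2))) ^ t)
  rw [Fintype.piFinset_univ, Finset.prod_const, Finset.card_univ, Fintype.card_fin] at h
  rw [← h]
  refine Finset.sum_le_sum fun ξ _ => ?_
  rw [Finset.prod_pow]
  exact pow_le_pow_left₀ (lazyEigenvalue_nonneg ξ) (lazyEigenvalue_le hd ξ) t

lemma exp_neg_sq_le (r : ℝ) (hr : 0 < r) (a : ℕ) :
    Real.exp (-(r * a) ^ 2) ≤ 2 / (1 + r * a) ^ 2 := by
  have h0 : 0 ≤ r * a := by positivity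
  rw [Real.exp_neg, ← one_div, div_le_div_iff₀ (Real.exp_pos _) (by positivity)]
  have h := Real.add_one_le_exp ((r * a) ^ 2)
  nlinarith [sq_nonneg (r * a - 1)]

lemma sum_exp_neg_sq_le (r : ℝ) (hr : 0 < r) (N : ℕ) :
    ∑ a ∈ Finset.range N, Real.exp (-(r * (a + 1 : ℕ)) ^ 2) ≤ 2 / r := by
  have h : ∑ a ∈ Finset.range N, Real.exp (-(r * (a + 1 : ℕ)) ^ 2) ≤
      2 / r - 2 / (r * (1 + r * N)) := by
    induction N with
    | zero => simp
    | succ N ih =>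
      rw [Finset.sum_range_succ]
      have h1 := exp_neg_sq_le r hr (N + 1)
      have hN : (0 : ℝ) ≤ r * N := by positivity
      have h2 : 2 / (1 + r * (N + 1 : ℕ)) ^ 2 ≤
          2 / (r * (1 + r * N)) - 2 / (r * (1 + r * (N + 1 : ℕ))) := by
        push_cast
        have e : 2 / (r * (1 + r * N)) - 2 / (r * (1 + r * (N + 1))) =
            2 / ((1 + r * N) * (1 + r * (N + 1))) := by
          field_simp
          ring
        rw [e, pow_two]
        gcongr
        linarith
      linarith
  have : 0 ≤ 2 / (r * (1 + r * N)) := by positivity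
  linarith

lemma sum_exp_valMinAbs_le (r : ℝ) (hr : 0 < r) :
    ∑ a : ZMod m, Real.exp (-(r * (a.valMinAbs : ℝ)) ^ 2) ≤ 1 + 4 / r := by
  have hinj : Function.Injective (fun a : ZMod m => a.valMinAbs) :=
    ZMod.injective_valMinAbs
  rw [← Finset.sum_image (s := Finset.univ) (g := fun a : ZMod m => a.valMinAbs)
    (f := fun j : ℤ => Real.exp (-(r * (j : ℝ)) ^ 2)) (fun a _ b _ h => hinj h)]
  have hsub : (Finset.univ.image fun a : ZMod m => a.valMinAbs) ⊆
      ((Finset.range (m + 1)).image fun j : ℕ => (j : ℤ)) ∪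
        ((Finset.range m).image fun j : ℕ => -((j + 1 : ℕ) : ℤ)) := by
    intro j hj
    obtain ⟨a, -, rfl⟩ := Finset.mem_image.1 hj
    have hmem := a.valMinAbs_mem_Ioc
    have h1 := hmem.1
    have h2 := hmem.2
    rw [Finset.mem_union]
    rcases le_or_gt 0 a.valMinAbs with h | h
    · left
      exact Finset.mem_image.2 ⟨a.valMinAbs.toNat, Finset.mem_range.2 (by omega), by simp [h]⟩
    · right
      refine Finset.mem_image.2 ⟨(-a.valMinAbs - 1).toNat, Finset.mem_range.2 (by omega), ?_⟩
      push_cast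
      rw [Int.toNat_of_nonneg (by omega)]
      ring
  refine (Finset.sum_le_sum_of_subset_of_nonneg hsub fun _ _ _ => (Real.exp_pos _).le).trans ?_
  rw [Finset.sum_union, Finset.sum_image, Finset.sum_image, Finset.sum_range_succ']
  · have h := sum_exp_neg_sq_le r hr m
    have e : ∑ x ∈ Finset.range m, Real.exp (-(r * ((-((x + 1 : ℕ) : ℤ) : ℤ) : ℝ)) ^ 2) =
        ∑ a ∈ Finset.range m, Real.exp (-(r * (a + 1 : ℕ)) ^ 2) :=
      Finset.sum_congr rfl fun x _ => by push_cast; congr 1; ring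
    have h0 : Real.exp (-(r * (((0 : ℕ) : ℤ) : ℝ)) ^ 2) = 1 := by simp
    rw [e, h0]
    have e4 : 4 / r = 2 / r + 2 / r := by ring
    rw [e4]
    push_cast at h ⊢
    linarith
  · intro a _ b _ h
    beta_reduce at h
    omega
  · intro a _ b _ h
    beta_reduce at h
    omega
  · rw [Finset.disjoint_left]
    intro x hx hy
    obtain ⟨a, -, rfl⟩ := Finset.mem_image.1 hx
    obtain ⟨b, -, hb⟩ := Finset.mem_image.1 hy
    omega

/-- On-diagonal heat kernel bound up to the mixing time `m ^ 2`. -/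
lemma heat_le (hd : d ≠ 0) {t : ℕ} (ht : 1 ≤ t) (htm : t ≤ m ^ 2) (z : Fin d → ZMod m) :
    heat t z ≤ ((1 + 2 * √d) / √t) ^ d := by
  have hd' : (0 : ℝ) < d := by exact_mod_cast Nat.pos_of_ne_zero hd
  have hm : (0 : ℝ) < m := by exact_mod_cast NeZero.pos m
  have ht' : (0 : ℝ) < t := by exact_mod_cast ht
  have hst : 0 < √(t : ℝ) := Real.sqrt_pos.2 ht'
  have hsd : 0 < √(d : ℝ) := Real.sqrt_pos.2 hd'
  refine (heat_le_pow hd t z).trans (pow_le_pow_left₀ (by positivity) ?_ d)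
  set r : ℝ := 2 * √t / (√d * m) with hr
  have hr0 : 0 < r := by positivity
  have hS : ∑ a : ZMod m, Real.exp (-(4 * (a.valMinAbs : ℝ) ^ 2 / (d * m ^ 2))) ^ t ≤
      1 + 4 / r := by
    refine le_trans (le_of_eq ?_) (sum_exp_valMinAbs_le (m := m) r hr0)
    refine Finset.sum_congr rfl fun a _ => ?_
    rw [← Real.exp_nat_mul]
    congr 1
    rw [hr, mul_pow, div_pow, mul_pow, mul_pow, Real.sq_sqrt ht'.le, Real.sq_sqrt hd'.le]
    ring
  have hmt : √(t : ℝ) ≤ m := by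
    rw [Real.sqrt_le_left hm.le]
    exact_mod_cast htm
  calc _ ≤ (1 + 4 / r) / m := by gcongr
    _ = 1 / m + 2 * √d / √t := by
      rw [hr]; field_simp; ring
    _ ≤ 1 / √t + 2 * √d / √t := by gcongr
    _ = _ := by ring

lemma heat_mixing_le (hd : d ≠ 0) (z : Fin d → ZMod m) :
    heat (m ^ 2) z ≤ (1 + 2 * √d) ^ d / (m : ℝ) ^ d := by
  have h := heat_le (m := m) (t := m ^ 2) hd (Nat.one_le_pow 2 m (NeZero.pos m)) le_rfl z
  rwa [Nat.cast_pow, Real.sqrt_sq (Nat.cast_nonneg m), div_pow] at h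

lemma one_le_green_zero : 1 ≤ green (0 : Fin d → ZMod m) := by
  have h := Finset.single_le_sum (f := fun t => heat t (0 : Fin d → ZMod m))
    (fun t _ => heat_nonneg t _) (Finset.mem_range.2 (pow_pos (NeZero.pos m) 2) : 0 ∈ Finset.range (m ^ 2))
  refine le_trans ?_ h
  simp [heat]

/-- In dimension at least three, the truncated Green function is uniformly small away from the
origin. -/
lemma exists_green_le {d : ℕ} (hd : 3 ≤ d) {η : ℝ} (hη : 0 < η) :
    ∃ R : ℕ, 1 ≤ R ∧ ∀ (m : ℕ) [NeZero m] (z : Fin d → ZMod m),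
      (∀ t < R, heat t z = 0) → green z ≤ η := by
  have hs := (summable_one_div_sqrt_pow hd).mul_left ((1 + 2 * √(d : ℝ)) ^ d)
  obtain ⟨s, hs⟩ := summable_iff_vanishing_norm.1 hs η hη
  obtain ⟨R, hR⟩ := s.exists_nat_subset_range
  refine ⟨R + 1, by omega, fun m _ z hz => ?_⟩
  have hsub : ∑ t ∈ Finset.range (m ^ 2) \ Finset.range (R + 1), heat t z = green z := by
    refine Finset.sum_subset Finset.sdiff_subset fun t h1 h2 => hz t ?_
    by_contra h3
    exact h2 (Finset.mem_sdiff.2 ⟨h1, by simpa using h3⟩)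
  rw [← hsub]
  have h := hs (Finset.range (m ^ 2) \ Finset.range (R + 1)) (by
    rw [Finset.disjoint_left]
    intro t h1 h2
    have h3 := Finset.mem_range.1 (hR h2)
    exact (Finset.mem_sdiff.1 h1).2 (Finset.mem_range.2 (by omega)))
  refine le_trans (Finset.sum_le_sum fun t ht => ?_) ((Real.le_norm_self _).trans h.le)
  simp only [Finset.mem_sdiff, Finset.mem_range, not_lt] at ht
  refine (heat_le (by omega) (by omega) ht.1.le z).trans (le_of_eq ?_)
  rw [div_pow]
  ring

end Heat
section Trajectories

variable {Ω : Type*} [Fintype Ω]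

/-- Probability that the chain with kernel `K` visits `B` during the first `T` steps. -/
def hitProb (K : Ω → Ω → ℝ) (B : Ω → Prop) : ℕ → Ω → ℝ
  | 0, x => if B x then 1 else 0
  | T + 1, x => if B x then 1 else ∑ y, K x y * hitProb K B T y

lemma trajProb_succ (K : Ω → Ω → ℝ) (x : Ω) (T : ℕ) (A : (Fin (T + 1 + 1) → Ω) → Prop) :
    trajProb K x (T + 1) A = ∑ y, K x y * trajProb K y T (fun ω => A (Fin.cons x ω)) := by
  simp only [trajProb]
  rw [← (Fin.consEquiv fun _ => Ω).sum_comp, Fintype.sum_prod_type]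
  simp only [Fin.consEquiv_apply, Fin.cons_zero, Fin.prod_univ_succ, Fin.castSucc_zero,
    Fin.cons_succ, Fin.castSucc_succ, Finset.mul_sum]
  rw [Finset.sum_eq_single x, Finset.sum_comm]
  · refine Finset.sum_congr rfl fun ω _ => ?_
    rw [Finset.sum_eq_single (ω 0)]
    · simp only [true_and, mul_ite, mul_zero]
      rfl
    · intro y _ hy
      rw [if_neg fun h => hy h.1.symm, mul_zero]
    · simp
  · intro a _ ha
    exact Finset.sum_eq_zero fun ω _ => if_neg fun h => ha h.1
  · simp

lemma trajProb_mono {K : Ω → Ω → ℝ} (hK : ∀ x y, 0 ≤ K x y) (x : Ω) (T : ℕ)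
    {A A' : (Fin (T + 1) → Ω) → Prop} (h : ∀ ω, A ω → A' ω) :
    trajProb K x T A ≤ trajProb K x T A' := by
  refine Finset.sum_le_sum fun ω _ => ?_
  by_cases h1 : ω 0 = x ∧ A ω
  · rw [if_pos h1, if_pos ⟨h1.1, h _ h1.2⟩]
  · rw [if_neg h1]
    split_ifs
    · exact Finset.prod_nonneg fun i _ => hK _ _
    · exact le_rfl

lemma trajProb_zero_le_one (K : Ω → Ω → ℝ) (x : Ω) (A : (Fin (0 + 1) → Ω) → Prop) :
    trajProb K x 0 A ≤ 1 := by
  simp only [trajProb, Finset.univ_eq_empty, Finset.prod_empty]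
  calc _ ≤ ∑ ω : Fin (0 + 1) → Ω, if ω = (fun _ => x) then (1 : ℝ) else 0 := by
        refine Finset.sum_le_sum fun ω _ => ?_
        split_ifs with h1 h2 h2
        · exact le_rfl
        · exact absurd (funext fun i => by rw [Fin.fin_one_eq_zero i]; exact h1.1) h2
        · exact zero_le_one
        · exact le_rfl
    _ ≤ 1 := by simp

lemma trajProb_le_one {K : Ω → Ω → ℝ} (hK : ∀ x y, 0 ≤ K x y) (hK1 : ∀ x, ∑ y, K x y = 1)
    (x : Ω) (T : ℕ) (A : (Fin (T + 1) → Ω) → Prop) : trajProb K x T A ≤ 1 := by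
  induction T generalizing x with
  | zero => exact trajProb_zero_le_one K x A
  | succ T ih =>
    rw [trajProb_succ, ← hK1 x]
    exact Finset.sum_le_sum fun y _ => mul_le_of_le_one_right (hK x y) (ih y _)

lemma trajProb_exists_le_hitProb {K : Ω → Ω → ℝ} (hK : ∀ x y, 0 ≤ K x y)
    (hK1 : ∀ x, ∑ y, K x y = 1) (B : Ω → Prop) (x : Ω) (T : ℕ) :
    trajProb K x T (fun ω => ∃ t, B (ω t)) ≤ hitProb K B T x := by
  induction T generalizing x with
  | zero =>
    simp only [hitProb]
    split_ifs with h
    · exact trajProb_zero_le_one K x _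
    · refine (Finset.sum_eq_zero fun ω _ => if_neg ?_).le
      rintro ⟨rfl, t, ht⟩
      rw [Fin.fin_one_eq_zero t] at ht
      exact h ht
  | succ T ih =>
    simp only [hitProb]
    split_ifs with h
    · exact trajProb_le_one hK hK1 x _ _
    · rw [trajProb_succ]
      refine Finset.sum_le_sum fun y _ => mul_le_mul_of_nonneg_left
        (le_trans (trajProb_mono hK y T ?_) (ih y)) (hK x y)
      rintro ω ⟨t, ht⟩
      induction t using Fin.cases with
      | zero => exact absurd ht h
      | succ t => exact ⟨t, ht⟩

lemma hitProb_nonneg {K : Ω → Ω → ℝ} (hK : ∀ x y, 0 ≤ K x y) (B : Ω → Prop) (T : ℕ) (x : Ω) :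
    0 ≤ hitProb K B T x := by
  induction T generalizing x with
  | zero => simp only [hitProb]; split_ifs <;> norm_num
  | succ T ih =>
    simp only [hitProb]
    split_ifs
    · exact zero_le_one
    · exact Finset.sum_nonneg fun y _ => mul_nonneg (hK x y) (ih y)

lemma hitProb_le_one {K : Ω → Ω → ℝ} (hK : ∀ x y, 0 ≤ K x y) (hK1 : ∀ x, ∑ y, K x y = 1)
    (B : Ω → Prop) (T : ℕ) (x : Ω) : hitProb K B T x ≤ 1 := by
  induction T generalizing x with
  | zero => simp only [hitProb]; split_ifs <;> norm_num
  | succ T ih =>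
    simp only [hitProb]
    split_ifs
    · exact le_rfl
    · rw [← hK1 x]
      exact Finset.sum_le_sum fun y _ => mul_le_of_le_one_right (hK x y) (ih y)

lemma hitProb_of_mem (K : Ω → Ω → ℝ) {B : Ω → Prop} (T : ℕ) {x : Ω} (hx : B x) :
    hitProb K B T x = 1 := by
  cases T <;> simp [hitProb, hx]

lemma hitProb_mono {K : Ω → Ω → ℝ} (hK : ∀ x y, 0 ≤ K x y) (B : Ω → Prop) (x : Ω) :
    Monotone fun T => hitProb K B T x := by
  refine monotone_nat_of_le_succ fun T => ?_
  induction T generalizing x with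
  | zero =>
    by_cases h : B x
    · simp [hitProb_of_mem, h]
    · rw [hitProb, if_neg h]
      exact hitProb_nonneg hK B _ x
  | succ T ih =>
    by_cases h : B x
    · simp [hitProb_of_mem, h]
    · rw [hitProb, if_neg h, hitProb, if_neg h]
      exact Finset.sum_le_sum fun y _ => mul_le_mul_of_nonneg_left (ih y) (hK x y)

end Trajectories

/-- The configuration obtained by moving the content of `v` onto `w`. -/
def moveParticle {V : Type*} [DecidableEq V] (x : V → Bool) (v w : V) : V → Bool :=
  Function.update (Function.update x v false) w true

lemma moveParticle_apply {V : Type*} [DecidableEq V] (x : V → Bool) (v w u : V) :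
    moveParticle x v w u = if u = w then true else if u = v then false else x u := by
  simp [moveParticle, Function.update_apply]

section Coalescence

variable {V : Type*} [Fintype V]

/-- The set of occupied sites of a configuration. -/
def occupied (x : V → Bool) : Finset V := Finset.univ.filter fun v => x v = true

lemma mem_occupied {x : V → Bool} {v : V} : v ∈ occupied x ↔ x v = true := by
  simp [occupied]

variable [DecidableEq V]

lemma occupied_moveParticle (x : V → Bool) (v w : V) :
    occupied (moveParticle x v w) = insert w ((occupied x).erase v) := by
  ext u
  rw [mem_occupied, moveParticle_apply, Finset.mem_insert, Finset.mem_erase, mem_occupied]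
  by_cases h1 : u = w
  · simp [h1]
  · by_cases h2 : u = v <;> simp [h1, h2]

lemma numParticles_moveParticle_le {x : V → Bool} {v : V} (hv : x v = true) (w : V) :
    numParticles (moveParticle x v w) ≤ numParticles x := by
  change (occupied _).card ≤ (occupied x).card
  rw [occupied_moveParticle]
  refine (Finset.card_insert_le _ _).trans ?_
  rw [Finset.card_erase_add_one (mem_occupied.2 hv)]

lemma numParticles_moveParticle {x : V → Bool} {v w : V} (hv : x v = true) (hw : x w = false) :
    numParticles (moveParticle x v w) = numParticles x := by
  change (occupied _).card = (occupied x).card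
  rw [occupied_moveParticle, Finset.card_insert_of_notMem,
    Finset.card_erase_add_one (mem_occupied.2 hv)]
  simp [mem_occupied, hw]

lemma sum_coalKernel_mul (G : SimpleGraph V) (q : ℝ) (x : V → Bool) (g : (V → Bool) → ℝ) :
    ∑ y, coalKernel G q x y * g y = (1 - q * numParticles x) * g x +
      ∑ v ∈ occupied x, ∑ w, if G.Adj v w then q / G.degree v * g (moveParticle x v w) else 0 := by
  simp only [coalKernel, add_mul, Finset.sum_add_distrib]
  congr 1
  · simp only [ite_mul, zero_mul, Finset.sum_ite_eq', Finset.mem_univ, if_true]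
    congr 2
    rw [← Finset.sum_filter, Finset.sum_const, nsmul_eq_mul, mul_comm]
    rfl
  · simp only [Finset.sum_mul]
    rw [Finset.sum_comm]
    rw [occupied, Finset.sum_filter]
    refine Finset.sum_congr rfl fun v _ => ?_
    rw [Finset.sum_comm]
    split_ifs with hv
    · refine Finset.sum_congr rfl fun w _ => ?_
      split_ifs with hw
      · rw [Finset.sum_eq_single (moveParticle x v w)]
        · rw [if_pos ⟨hv, hw, rfl⟩]
        · intro y _ hy
          rw [if_neg fun h => hy h.2.2, zero_mul]
        · simp
      · exact Finset.sum_eq_zero fun y _ => by rw [if_neg fun h => hw h.2.1, zero_mul]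
    · exact Finset.sum_eq_zero fun w _ => Finset.sum_eq_zero fun y _ => by
        rw [if_neg fun h => hv h.1, zero_mul]

lemma coalKernel_nonneg (G : SimpleGraph V) {q : ℝ} (hq : 0 ≤ q) (hq1 : q * Fintype.card V ≤ 1)
    (x y : V → Bool) : 0 ≤ coalKernel G q x y := by
  refine add_nonneg ?_ (Finset.sum_nonneg fun v _ => Finset.sum_nonneg fun w _ => ?_)
  · split_ifs
    · have h : ∑ v : V, (if x v = true then q else 0) ≤ ∑ _v : V, q :=
        Finset.sum_le_sum fun v _ => by split_ifs <;> simp [hq]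
      rw [Finset.sum_const, nsmul_eq_mul, Finset.card_univ, mul_comm] at h
      linarith
    · exact le_rfl
  · split_ifs
    · positivity
    · exact le_rfl

end Coalescence
section Torus

variable {d m : ℕ}

lemma torusGraph_adj (hm : 3 ≤ m) (v w : Fin d → ZMod m) :
    (torusGraph m d).Adj v w ↔ ∃ i, w = v + Pi.single i 1 ∨ w = v - Pi.single i 1 := by
  have : Fact (1 < m) := ⟨by omega⟩
  have hs : ∀ i : Fin d, (fun j => if j = i then (1 : ZMod m) else 0) = Pi.single i 1 := by
    intro i; ext j; simp [Pi.single_apply]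
  have hne : ∀ i : Fin d, (Pi.single i (1 : ZMod m) : Fin d → ZMod m) ≠ 0 := by
    intro i h
    exact one_ne_zero (α := ZMod m) (by simpa using congrFun h i)
  simp only [torusGraph, SimpleGraph.fromRel_adj, hs]
  constructor
  · rintro ⟨-, ⟨i, hi⟩ | ⟨i, hi⟩⟩
    · exact ⟨i, Or.inl hi⟩
    · exact ⟨i, Or.inr (by rw [hi]; simp)⟩
  · rintro ⟨i, rfl | rfl⟩
    · exact ⟨by simp [hne i], Or.inl ⟨i, rfl⟩⟩
    · refine ⟨fun h => hne i ?_, Or.inr ⟨i, by simp⟩⟩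
      exact sub_eq_self.1 h.symm

/-- Twice the sum of `f (u - v)` over unordered pairs of distinct sites of `S`. -/
def pairEnergy (f : (Fin d → ZMod m) → ℝ) (S : Finset (Fin d → ZMod m)) : ℝ :=
  ∑ u ∈ S, ∑ v ∈ S, if u = v then 0 else f (u - v)

lemma pairEnergy_nonneg {f : (Fin d → ZMod m) → ℝ} (hf : ∀ z, 0 ≤ f z)
    (S : Finset (Fin d → ZMod m)) : 0 ≤ pairEnergy f S :=
  Finset.sum_nonneg fun u _ => Finset.sum_nonneg fun v _ => by
    split_ifs
    · exact le_rfl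
    · exact hf _

lemma pairEnergy_insert {f : (Fin d → ZMod m) → ℝ} (hf : ∀ z, f (-z) = f z)
    {S : Finset (Fin d → ZMod m)} {w : Fin d → ZMod m} (hw : w ∉ S) :
    pairEnergy f (insert w S) = pairEnergy f S + 2 * ∑ u ∈ S, f (w - u) := by
  simp only [pairEnergy, Finset.sum_insert hw, Finset.sum_add_distrib, if_true, zero_add]
  have h1 : ∑ u ∈ S, (if w = u then 0 else f (w - u)) = ∑ u ∈ S, f (w - u) :=
    Finset.sum_congr rfl fun u hu => if_neg fun h : w = u => hw (h ▸ hu)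
  have h2 : ∑ u ∈ S, (if u = w then 0 else f (u - w)) = ∑ u ∈ S, f (w - u) :=
    Finset.sum_congr rfl fun u hu => by rw [if_neg fun h : u = w => hw (h ▸ hu), ← hf, neg_sub]
  rw [h1, h2]
  ring

lemma pairEnergy_le {f : (Fin d → ZMod m) → ℝ} {S : Finset (Fin d → ZMod m)} {η : ℝ} (hη : 0 ≤ η)
    (h : ∀ u ∈ S, ∀ v ∈ S, u ≠ v → f (u - v) ≤ η) : pairEnergy f S ≤ S.card * (S.card * η) := by
  have : pairEnergy f S ≤ ∑ _u ∈ S, ∑ _v ∈ S, η := by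
    refine Finset.sum_le_sum fun u hu => Finset.sum_le_sum fun v hv => ?_
    split_ifs with huv
    · exact hη
    · exact h u hu v hv huv
  simpa using this

variable [NeZero m]

lemma sum_torusGraph_adj (hm : 3 ≤ m) (v : Fin d → ZMod m) (g : (Fin d → ZMod m) → ℝ) :
    ∑ w, (if (torusGraph m d).Adj v w then g w else 0) =
      ∑ i, (g (v + Pi.single i 1) + g (v - Pi.single i 1)) := by
  have : Fact (1 < m) := ⟨by omega⟩
  have h2 : (1 : ZMod m) ≠ -1 := by
    intro h
    have h' : ((2 : ℕ) : ZMod m) = 0 := by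
      push_cast
      linear_combination h
    have := Nat.le_of_dvd (by norm_num) ((ZMod.natCast_eq_zero_iff 2 m).1 h')
    omega
  let f : Fin d × Bool → Fin d → ZMod m :=
    fun p => v + Pi.single p.1 (if p.2 then 1 else -1)
  have hf : Function.Injective f := by
    rintro ⟨i, a⟩ ⟨j, b⟩ h
    have h' := add_left_cancel h
    have hij : i = j := by
      by_contra hij
      have h0 := congrFun h' i
      rw [Pi.single_eq_same, Pi.single_eq_of_ne hij] at h0
      revert h0
      cases a <;> simp
    subst hij
    have h0 := congrFun h' i
    rw [Pi.single_eq_same, Pi.single_eq_same] at h0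
    revert h0
    cases a <;> cases b <;> simp [h2, h2.symm]
  have himg : (Finset.univ.filter fun w => (torusGraph m d).Adj v w) = Finset.univ.image f := by
    ext w
    simp only [Finset.mem_filter, Finset.mem_univ, true_and, Finset.mem_image, Prod.exists,
      Bool.exists_bool, torusGraph_adj hm, f]
    refine exists_congr fun i => ?_
    simp only [Bool.false_eq_true, if_false, if_true, Pi.single_neg, ← sub_eq_add_neg]
    rw [or_comm, eq_comm, @eq_comm _ w]
  rw [← Finset.sum_filter, himg, Finset.sum_image fun a _ b _ h => hf h, Fintype.sum_prod_type]
  simp [f, Pi.single_neg, sub_eq_add_neg]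

lemma degree_torusGraph (hm : 3 ≤ m) (v : Fin d → ZMod m) :
    ((torusGraph m d).degree v : ℝ) = 2 * d := by
  have h := sum_torusGraph_adj hm v fun _ => 1
  rw [← Finset.sum_filter, Finset.sum_const, nsmul_eq_mul, mul_one] at h
  rw [← SimpleGraph.card_neighborFinset_eq_degree, SimpleGraph.neighborFinset_eq_filter, h]
  simp
  ring

/-- The kernel of the coalescence process on the torus. -/
def torusKernel (d m : ℕ) [NeZero m] (q : ℝ) :
    ((Fin d → ZMod m) → Bool) → ((Fin d → ZMod m) → Bool) → ℝ :=
  coalKernel (torusGraph m d) q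

lemma sum_torusKernel_mul (hm : 3 ≤ m) (q : ℝ) (x : (Fin d → ZMod m) → Bool)
    (g : ((Fin d → ZMod m) → Bool) → ℝ) :
    ∑ y, torusKernel d m q x y * g y = (1 - q * numParticles x) * g x +
      q / (2 * d) * ∑ v ∈ occupied x, ∑ i,
        (g (moveParticle x v (v + Pi.single i 1)) + g (moveParticle x v (v - Pi.single i 1))) := by
  rw [torusKernel, sum_coalKernel_mul]
  congr 1
  rw [Finset.mul_sum]
  refine Finset.sum_congr rfl fun v _ => ?_
  rw [sum_torusGraph_adj hm v fun w => q / (torusGraph m d).degree v * g (moveParticle x v w),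
    degree_torusGraph hm, Finset.mul_sum]
  exact Finset.sum_congr rfl fun i _ => by ring

lemma torusKernel_nonneg {q : ℝ} (hq : 0 ≤ q) (hq1 : q * (m : ℝ) ^ d ≤ 1)
    (x y : (Fin d → ZMod m) → Bool) : 0 ≤ torusKernel d m q x y := by
  refine coalKernel_nonneg _ hq ?_ x y
  simpa [ZMod.card] using hq1

lemma sum_torusKernel (hd : d ≠ 0) (hm : 3 ≤ m) (q : ℝ) (x : (Fin d → ZMod m) → Bool) :
    ∑ y, torusKernel d m q x y = 1 := by
  have hd' : (d : ℝ) ≠ 0 := by exact_mod_cast hd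
  have h := sum_torusKernel_mul hm q x fun _ => 1
  simp only [mul_one, Finset.sum_const, Finset.card_univ, Fintype.card_fin, nsmul_eq_mul] at h
  rw [h]
  have hn : (numParticles x : ℝ) = (occupied x).card := rfl
  rw [hn]
  field_simp
  ring

/-- The energy of a configuration, set to `1` as soon as a collision has occurred. -/
def collisionEnergy (k : ℕ) (x : (Fin d → ZMod m) → Bool) : ℝ :=
  if numParticles x < k then 1 else pairEnergy green (occupied x)

lemma collisionEnergy_moveParticle_le {x : (Fin d → ZMod m) → Bool} {v : Fin d → ZMod m} {k : ℕ}
    (hx : numParticles x = k) (hv : x v = true) (w : Fin d → ZMod m) :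
    collisionEnergy k (moveParticle x v w) ≤ pairEnergy green ((occupied x).erase v) +
      2 * ∑ u ∈ (occupied x).erase v, green (w - u) := by
  have hcard : ((occupied x).erase v).card + 1 = k := by
    rw [Finset.card_erase_add_one (mem_occupied.2 hv), ← hx]; rfl
  have hn : numParticles (moveParticle x v w) = (insert w ((occupied x).erase v)).card := by
    rw [← occupied_moveParticle]; rfl
  by_cases hw : w ∈ (occupied x).erase v
  · rw [Finset.insert_eq_of_mem hw] at hn
    rw [collisionEnergy, if_pos (by omega)]
    have h1 := pairEnergy_nonneg green_nonneg ((occupied x).erase v)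
    have h2 := Finset.single_le_sum (f := fun u => green (w - u)) (fun u _ => green_nonneg _) hw
    have h3 := one_le_green_zero (d := d) (m := m)
    simp only [sub_self] at h2
    linarith
  · rw [Finset.card_insert_of_notMem hw] at hn
    rw [collisionEnergy, if_neg (by omega), occupied_moveParticle, pairEnergy_insert green_neg hw]

lemma sum_green_shift_le (hd : d ≠ 0) {A : Finset (Fin d → ZMod m)} {v : Fin d → ZMod m}
    (hv : v ∉ A) :
    ∑ i : Fin d, ((∑ u ∈ A, green (v + Pi.single i 1 - u)) +
        ∑ u ∈ A, green (v - Pi.single i 1 - u)) ≤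
      2 * d * (∑ u ∈ A, green (v - u)) +
        A.card * (4 * d * ((1 + 2 * √d) ^ d / (m : ℝ) ^ d)) := by
  simp only [← Finset.sum_add_distrib]
  rw [Finset.sum_comm, Finset.mul_sum, ← nsmul_eq_mul, ← Finset.sum_const,
    ← Finset.sum_add_distrib]
  refine Finset.sum_le_sum fun u hu => ?_
  have hne : v - u ≠ 0 := sub_ne_zero.2 fun h => hv (h ▸ hu)
  have e1 : ∀ i : Fin d, v + Pi.single i 1 - u = v - u + Pi.single i 1 := fun i => by abel
  have e2 : ∀ i : Fin d, v - Pi.single i 1 - u = v - u - Pi.single i 1 := fun i => by abel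
  simp only [e1, e2]
  rw [sum_green_neighbors hd hne]
  have := heat_mixing_le hd (v - u)
  gcongr

lemma sum_collisionEnergy_moveParticle_le (hd : d ≠ 0) {x : (Fin d → ZMod m) → Bool} {k : ℕ}
    (hx : numParticles x = k) {v : Fin d → ZMod m} (hv : v ∈ occupied x) :
    ∑ i, (collisionEnergy k (moveParticle x v (v + Pi.single i 1)) +
        collisionEnergy k (moveParticle x v (v - Pi.single i 1))) ≤
      2 * d * (collisionEnergy k x + 4 * k * ((1 + 2 * √d) ^ d / (m : ℝ) ^ d)) := by
  have hE : collisionEnergy k x = pairEnergy green (occupied x) := by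
    rw [collisionEnergy, if_neg (by omega)]
  have hmove := collisionEnergy_moveParticle_le hx (mem_occupied.1 hv)
  have hsum := sum_green_shift_le hd (Finset.notMem_erase v (occupied x))
  have hins : pairEnergy green (occupied x) = pairEnergy green ((occupied x).erase v) +
      2 * ∑ u ∈ (occupied x).erase v, green (v - u) := by
    rw [← pairEnergy_insert green_neg (Finset.notMem_erase v (occupied x)), Finset.insert_erase hv]
  have hcard : (((occupied x).erase v).card : ℝ) ≤ k := by
    rw [← hx]
    exact_mod_cast Finset.card_le_card (Finset.erase_subset v (occupied x))
  have hC : (0 : ℝ) ≤ 4 * d * ((1 + 2 * √d) ^ d / (m : ℝ) ^ d) := by positivity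
  have hcard' := mul_le_mul_of_nonneg_right hcard hC
  refine (Finset.sum_le_sum fun i _ => add_le_add (hmove _) (hmove _)).trans ?_
  rw [hE, hins]
  calc _ = 2 * d * pairEnergy green ((occupied x).erase v) +
        2 * ∑ i : Fin d, ((∑ u ∈ (occupied x).erase v, green (v + Pi.single i 1 - u)) +
          ∑ u ∈ (occupied x).erase v, green (v - Pi.single i 1 - u)) := by
        simp only [Finset.sum_add_distrib, ← Finset.mul_sum, Finset.sum_const, Finset.card_univ,
          Fintype.card_fin, nsmul_eq_mul]
        ring
    _ ≤ _ := by linarith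

/-- The collision energy is almost superharmonic. -/
lemma sum_torusKernel_mul_collisionEnergy_le (hd : d ≠ 0) (hm : 3 ≤ m) {q : ℝ} (hq : 0 ≤ q)
    {x : (Fin d → ZMod m) → Bool} {k : ℕ} (hx : numParticles x = k) :
    ∑ y, torusKernel d m q x y * collisionEnergy k y ≤
      collisionEnergy k x + q * (4 * k ^ 2 * ((1 + 2 * √d) ^ d / (m : ℝ) ^ d)) := by
  have hd' : (0 : ℝ) < d := by exact_mod_cast Nat.pos_of_ne_zero hd
  have hcard : ((occupied x).card : ℝ) = k := by rw [← hx]; rfl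
  have h := Finset.sum_le_sum fun v hv => sum_collisionEnergy_moveParticle_le hd hx (v := v) hv
  rw [Finset.sum_const, nsmul_eq_mul, hcard] at h
  have hmul := mul_le_mul_of_nonneg_left h (by positivity : 0 ≤ q / (2 * d))
  have hcancel : ∀ Y : ℝ, q / (2 * d) * (k * (2 * d * Y)) = q * k * Y := fun Y => by field_simp
  rw [hcancel] at hmul
  rw [sum_torusKernel_mul hm, hx]
  refine (add_le_add le_rfl hmul).trans (le_of_eq ?_)
  ring

lemma hitProb_le_collisionEnergy (hd : d ≠ 0) (hm : 3 ≤ m) {q : ℝ} (hq : 0 ≤ q)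
    (hq1 : q * (m : ℝ) ^ d ≤ 1) (T k : ℕ) {x : (Fin d → ZMod m) → Bool}
    (hx : numParticles x ≤ k) :
    hitProb (torusKernel d m q) (fun y => numParticles y < k) T x ≤
      collisionEnergy k x + T * (q * (4 * k ^ 2 * ((1 + 2 * √d) ^ d / (m : ℝ) ^ d))) := by
  set D : ℝ := q * (4 * k ^ 2 * ((1 + 2 * √d) ^ d / (m : ℝ) ^ d)) with hD
  have hD0 : 0 ≤ D := by positivity
  have hlt : ∀ (T : ℕ) (x : (Fin d → ZMod m) → Bool), numParticles x < k →
      hitProb (torusKernel d m q) (fun y => numParticles y < k) T x ≤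
        collisionEnergy k x + T * D := by
    intro T x h
    rw [hitProb_of_mem _ (B := fun y => numParticles y < k) _ h, collisionEnergy, if_pos h]
    have : 0 ≤ T * D := by positivity
    linarith
  induction T generalizing x with
  | zero =>
    by_cases h : numParticles x < k
    · exact hlt 0 x h
    · rw [hitProb, if_neg h, collisionEnergy, if_neg h]
      have := pairEnergy_nonneg green_nonneg (occupied x)
      simpa using this
  | succ T ih =>
    by_cases h : numParticles x < k
    · exact hlt _ x h
    · have hxk : numParticles x = k := by omega
      rw [hitProb, if_neg h]
      have hstep : ∑ y, torusKernel d m q x y *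
          hitProb (torusKernel d m q) (fun y => numParticles y < k) T y ≤
          ∑ y, torusKernel d m q x y * (collisionEnergy k y + T * D) := by
        have hcoef : 0 ≤ 1 - q * numParticles x := by
          have h1 : (numParticles x : ℝ) ≤ (m : ℝ) ^ d := by
            have : numParticles x ≤ Fintype.card (Fin d → ZMod m) :=
              Finset.card_le_univ (occupied x)
            simp only [Fintype.card_pi, ZMod.card, Finset.prod_const, Finset.card_univ,
              Fintype.card_fin] at this
            exact_mod_cast this
          nlinarith [mul_le_mul_of_nonneg_left h1 hq]
        rw [sum_torusKernel_mul hm, sum_torusKernel_mul hm]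
        have hmv : ∀ v ∈ occupied x, ∀ w, hitProb (torusKernel d m q)
            (fun y => numParticles y < k) T (moveParticle x v w) ≤
            collisionEnergy k (moveParticle x v w) + T * D := fun v hv w =>
          ih ((numParticles_moveParticle_le (mem_occupied.1 hv) w).trans hx)
        refine add_le_add (mul_le_mul_of_nonneg_left (ih hx) hcoef)
          (mul_le_mul_of_nonneg_left ?_ (by positivity))
        exact Finset.sum_le_sum fun v hv => Finset.sum_le_sum fun i _ =>
          add_le_add (hmv v hv _) (hmv v hv _)
      refine hstep.trans ?_
      simp only [mul_add, Finset.sum_add_distrib]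
      rw [← Finset.sum_mul, sum_torusKernel hd hm]
      have := sum_torusKernel_mul_collisionEnergy_le hd hm hq hxk
      push_cast
      linarith

end Torus
section Spreading

variable {d m : ℕ} [NeZero m]

/-- A particle move onto a vacant neighboring site costs at most a constant factor in the survival
probability, provided the time horizon is at least `1 / q`. -/
lemma survival_moveParticle (hd : d ≠ 0) (hm : 3 ≤ m) {q : ℝ} (hq : 0 ≤ q)
    (hq1 : q * (m : ℝ) ^ d ≤ 1) {T k : ℕ} (hT : 1 ≤ T * q) (hk : 1 ≤ k)
    {x : (Fin d → ZMod m) → Bool} (hx : numParticles x = k) {v : Fin d → ZMod m}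
    (hv : x v = true) (i : Fin d) :
    1 / (4 * d * k) * (1 - hitProb (torusKernel d m q) (fun y => numParticles y < k) T
        (moveParticle x v (v - Pi.single i 1))) ≤
      1 - hitProb (torusKernel d m q) (fun y => numParticles y < k) T x := by
  have hd' : (0 : ℝ) < d := by exact_mod_cast Nat.pos_of_ne_zero hd
  have hk' : (1 : ℝ) ≤ k := by exact_mod_cast hk
  have hK := torusKernel_nonneg (d := d) (m := m) hq hq1
  have hK1 := sum_torusKernel hd hm q
  set H := hitProb (torusKernel d m q) (fun y => numParticles y < k) with hH
  set b := 1 - H T (moveParticle x v (v - Pi.single i 1)) with hb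
  have hb0 : 0 ≤ b := sub_nonneg.2 (hitProb_le_one hK hK1 _ _ _)
  have hkm : (k : ℝ) ≤ (m : ℝ) ^ d := by
    have : numParticles x ≤ Fintype.card (Fin d → ZMod m) := Finset.card_le_univ (occupied x)
    simp only [Fintype.card_pi, ZMod.card, Finset.prod_const, Finset.card_univ,
      Fintype.card_fin, hx] at this
    exact_mod_cast this
  have hr0 : 0 ≤ 1 - q * k := by nlinarith [mul_le_mul_of_nonneg_left hkm hq]
  have hstep : ∀ t, t ≤ T → (1 - q * k) * (1 - H t x) + q / (2 * d) * b ≤ 1 - H (t + 1) x := by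
    intro t ht
    have h1 : H (t + 1) x = ∑ y, torusKernel d m q x y * H t y := by
      rw [hH, hitProb, if_neg (by omega)]
    have h2 : 1 - H (t + 1) x = ∑ y, torusKernel d m q x y * (1 - H t y) := by
      simp only [mul_sub, mul_one, Finset.sum_sub_distrib]
      rw [hK1, h1]
    rw [h2, sum_torusKernel_mul hm, hx]
    have hnn : ∀ y, 0 ≤ 1 - H t y := fun y => sub_nonneg.2 (hitProb_le_one hK hK1 _ _ _)
    have h3 : b ≤ 1 - H t (moveParticle x v (v - Pi.single i 1)) :=
      sub_le_sub_left (hitProb_mono hK _ _ ht) 1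
    have h4 := Finset.single_le_sum
      (f := fun i => (1 - H t (moveParticle x v (v + Pi.single i 1))) +
        (1 - H t (moveParticle x v (v - Pi.single i 1))))
      (fun i _ => add_nonneg (hnn _) (hnn _)) (Finset.mem_univ i)
    have h5 := Finset.single_le_sum
      (f := fun v => ∑ i, ((1 - H t (moveParticle x v (v + Pi.single i 1))) +
        (1 - H t (moveParticle x v (v - Pi.single i 1)))))
      (fun v _ => Finset.sum_nonneg fun i _ => add_nonneg (hnn _) (hnn _)) (mem_occupied.2 hv)
    have h6 := hnn (moveParticle x v (v + Pi.single i 1))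
    beta_reduce at h4 h5
    refine add_le_add le_rfl (mul_le_mul_of_nonneg_left ?_ (by positivity))
    linarith
  have hind : ∀ t, t ≤ T → b / (2 * d * k) * (1 - (1 - q * k) ^ t) ≤ 1 - H t x := by
    intro t
    induction t with
    | zero =>
      intro _
      simpa using hitProb_le_one hK hK1 _ 0 x
    | succ t ih =>
      intro ht
      have h1 := mul_le_mul_of_nonneg_left (ih (by omega)) hr0
      refine le_trans (le_of_eq ?_) ((add_le_add h1 le_rfl).trans (hstep t (by omega)))
      field_simp
      ring
  have hpow : (1 - q * k) ^ T ≤ 1 / 2 := by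
    have h1 : (1 - q * k) ^ T ≤ Real.exp (-(q * k)) ^ T :=
      pow_le_pow_left₀ hr0 (Real.one_sub_le_exp_neg _) T
    rw [← Real.exp_nat_mul, mul_neg, Real.exp_neg] at h1
    refine h1.trans ?_
    rw [one_div]
    refine inv_anti₀ two_pos ?_
    have h2 := Real.add_one_le_exp ((T : ℝ) * (q * k))
    nlinarith
  refine le_trans ?_ (hind T le_rfl)
  have h : b / (2 * d * k) * (1 / 2) ≤ b / (2 * d * k) * (1 - (1 - q * k) ^ T) :=
    mul_le_mul_of_nonneg_left (by linarith) (by positivity)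
  refine le_trans (le_of_eq ?_) h
  field_simp
  ring

/-- `CanReach i P M x` means that a configuration satisfying `P` can be reached from `x` by
`M` successive unit moves in direction `-e_i`, each onto a vacant site. -/
def CanReach (i : Fin d) (P : ((Fin d → ZMod m) → Bool) → Prop) :
    ℕ → ((Fin d → ZMod m) → Bool) → Prop
  | 0, x => P x
  | M + 1, x => ∃ v : Fin d → ZMod m, x v = true ∧ x (v - Pi.single i 1) = false ∧
      CanReach i P M (moveParticle x v (v - Pi.single i 1))

lemma survival_of_canReach (hd : d ≠ 0) (hm : 3 ≤ m) {q : ℝ} (hq : 0 ≤ q)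
    (hq1 : q * (m : ℝ) ^ d ≤ 1) {T k : ℕ} (hT : 1 ≤ T * q) (hk : 1 ≤ k) {i : Fin d}
    {P : ((Fin d → ZMod m) → Bool) → Prop} {s : ℝ}
    (hP : ∀ y, P y → numParticles y = k →
      s ≤ 1 - hitProb (torusKernel d m q) (fun y => numParticles y < k) T y)
    {M : ℕ} {x : (Fin d → ZMod m) → Bool} (hx : numParticles x = k) (hM : CanReach i P M x) :
    (1 / (4 * d * k)) ^ M * s ≤
      1 - hitProb (torusKernel d m q) (fun y => numParticles y < k) T x := by
  induction M generalizing x with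
  | zero => simpa using hP x hM hx
  | succ M ih =>
    obtain ⟨v, hv, hw, h⟩ := hM
    have h1 := ih ((numParticles_moveParticle hv hw).trans hx) h
    have h2 := survival_moveParticle hd hm hq hq1 hT hk hx hv i
    refine le_trans ?_ h2
    rw [pow_succ', mul_assoc]
    exact mul_le_mul_of_nonneg_left h1 (by positivity)

/-- The `i`-th coordinate measured upwards from level `a`. -/
def height (i : Fin d) (a : ZMod m) (v : Fin d → ZMod m) : ℕ := (v i - a).val

lemma height_sub_single (i : Fin d) (a : ZMod m) (v : Fin d → ZMod m) {j : ℕ}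
    (hj : j ≤ height i a v) :
    height i a (v - Pi.single i (j : ZMod m)) = height i a v - j := by
  have hlt : j < m := hj.trans_lt (ZMod.val_lt _)
  have hval : ((j : ℕ) : ZMod m).val = j := ZMod.val_natCast_of_lt hlt
  have h : (v - Pi.single i (j : ZMod m) : Fin d → ZMod m) i - a = (v i - a) - (j : ZMod m) := by
    simp only [Pi.sub_apply, Pi.single_eq_same]; ring
  rw [height, h, ZMod.val_sub (by rw [hval]; exact hj), hval, height]

/-- The heights of the particles are at least `R` and differ pairwise by at least `R`. -/
def HeightSeparated (i : Fin d) (a : ZMod m) (R : ℕ) (x : (Fin d → ZMod m) → Bool) : Prop :=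
  ∀ u v, x u = true → x v = true → u ≠ v → R ≤ height i a u ∧
    (height i a u + R ≤ height i a v ∨ height i a v + R ≤ height i a u)

lemma heat_eq_zero_of_heightSeparated {i : Fin d} {a : ZMod m} {R : ℕ}
    {x : (Fin d → ZMod m) → Bool} (hx : HeightSeparated i a R x) {u v : Fin d → ZMod m}
    (hu : x u = true) (hv : x v = true) (huv : u ≠ v) {t : ℕ} (ht : t < R) :
    heat t (u - v) = 0 := by
  by_contra h
  obtain ⟨c, hc, hcz⟩ := exists_int_of_heat_ne_zero t _ h i
  rw [abs_le] at hc
  obtain ⟨hRu, hsep⟩ := hx u v hu hv huv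
  have hRv := (hx v u hv hu huv.symm).1
  have hum : height i a u < m := ZMod.val_lt _
  have hvm : height i a v < m := ZMod.val_lt _
  have hdvd : (m : ℤ) ∣ (height i a u : ℤ) - height i a v - c := by
    rw [← ZMod.intCast_zmod_eq_zero_iff_dvd]
    push_cast
    rw [← hcz, height, height, ZMod.natCast_zmod_val, ZMod.natCast_zmod_val, Pi.sub_apply]
    ring
  have h0 : (height i a u : ℤ) - height i a v - c = 0 := by
    refine Int.eq_zero_of_abs_lt_dvd hdvd ?_
    rw [abs_lt]
    omega
  omega

lemma canReach_slide {i : Fin d} {a : ZMod m}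
    {P : ((Fin d → ZMod m) → Bool) → Prop} {M : ℕ}
    (j : ℕ) {x : (Fin d → ZMod m) → Bool} {v : Fin d → ZMod m} (hv : x v = true)
    (hj : j ≤ height i a v)
    (hfree : ∀ u, x u = true → u ≠ v → height i a u + j < height i a v ∨
      height i a v ≤ height i a u)
    (h : CanReach i P M (moveParticle x v (v - Pi.single i (j : ZMod m)))) :
    CanReach i P (M + j) x := by
  induction j generalizing x v with
  | zero =>
    have : moveParticle x v (v - Pi.single i ((0 : ℕ) : ZMod m)) = x := by
      ext1 u
      rw [moveParticle_apply]
      simp only [Nat.cast_zero, Pi.single_zero, sub_zero]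
      split_ifs with h1
      · rw [h1, hv]
      · rfl
    rwa [this] at h
  | succ j ih =>
    have hh : height i a (v - Pi.single i 1) = height i a v - 1 := by
      have := height_sub_single i a v (j := 1) (by omega)
      rwa [Nat.cast_one] at this
    set v1 := v - Pi.single i 1 with hv1
    have hne : v1 ≠ v := by
      intro h
      rw [h] at hh
      omega
    have hx1 : x v1 = false := by
      by_contra hc
      have := hfree v1 (by simpa using hc) hne
      omega
    refine ⟨v, hv, hx1, ih (v := v1) ?_ (by omega) ?_ ?_⟩
    · rw [moveParticle_apply, if_pos rfl]
    · intro u hu huv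
      rw [moveParticle_apply, if_neg huv] at hu
      by_cases huv' : u = v
      · simp [huv'] at hu
      · rw [if_neg huv'] at hu
        have := hfree u hu huv'
        omega
    · have e1 : v1 - Pi.single i (j : ZMod m) = v - Pi.single i ((j + 1 : ℕ) : ZMod m) := by
        rw [hv1, sub_sub, ← Pi.single_add]
        push_cast
        rw [add_comm]
      rw [e1]
      convert h using 1
      ext1 u
      simp only [moveParticle_apply, ← hv1]
      by_cases h1 : u = v - Pi.single i ((j + 1 : ℕ) : ZMod m)
      · rw [if_pos h1, if_pos h1]
      · rw [if_neg h1, if_neg h1]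
        by_cases h2 : u = v1
        · rw [if_pos h2, h2, if_neg hne, hx1]
        · rw [if_neg h2, if_neg h2]

lemma canReach_heightSeparated {i : Fin d} {a : ZMod m} {R : ℕ} (hR : 1 ≤ R)
    (b : ℕ) {A B : Finset (Fin d → ZMod m)} {x : (Fin d → ZMod m) → Bool} (hb : B.card = b)
    (hx : ∀ u, x u = true ↔ u ∈ A ∨ u ∈ B)
    (hA : ∀ u ∈ A, R ≤ height i a u)
    (hAA : ∀ u ∈ A, ∀ v ∈ A, u ≠ v →
      height i a u + R ≤ height i a v ∨ height i a v + R ≤ height i a u)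
    (hAB : ∀ u ∈ A, ∀ v ∈ B, height i a u + b * R ≤ height i a v)
    (hB : ∀ v ∈ B, R + b * R ≤ height i a v) :
    ∃ M ≤ b * b * R, CanReach i (HeightSeparated i a R) M x := by
  induction b generalizing A B x with
  | zero =>
    rw [Finset.card_eq_zero] at hb
    subst hb
    refine ⟨0, by simp, fun u v hu hv huv => ?_⟩
    simp only [hx, Finset.notMem_empty, or_false] at hu hv
    exact ⟨hA u hu, hAA u hu v hv huv⟩
  | succ b ih =>
    obtain ⟨v, hvB, hmin⟩ := Finset.exists_min_image B (height i a)
      (Finset.card_pos.1 (by omega))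
    have hbR : (b + 1) * R = b * R + R := by ring
    rw [hbR] at hAB hB
    have hvR := hB v hvB
    have hvA : v ∉ A := fun h => by have := hAB v h v hvB; omega
    have hxv : x v = true := (hx v).2 (Or.inr hvB)
    have hh := height_sub_single i a v (j := b * R) (by omega)
    set v' := v - Pi.single i ((b * R : ℕ) : ZMod m) with hv'
    have hmain : ∃ M ≤ b * b * R, CanReach i (HeightSeparated i a R) M (moveParticle x v v') := by
      refine ih (A := insert v' A) (B := B.erase v) ?_ ?_ ?_ ?_ ?_ ?_
      · rw [Finset.card_erase_of_mem hvB]; omega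
      · intro u
        rw [moveParticle_apply, Finset.mem_insert, Finset.mem_erase]
        by_cases h1 : u = v'
        · simp [h1]
        · by_cases h2 : u = v
          · simp only [h2] at h1 ⊢
            simp [h1, hvA]
          · simp [h1, h2, hx]
      · intro u hu
        rcases Finset.mem_insert.1 hu with rfl | hu
        · omega
        · exact hA u hu
      · intro u hu w hw huw
        rcases Finset.mem_insert.1 hu with rfl | hu <;> rcases Finset.mem_insert.1 hw with rfl | hw
        · exact absurd rfl huw
        · have := hAB w hw v hvB
          omega
        · have := hAB u hu v hvB
          omega
        · exact hAA u hu w hw huw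
      · intro u hu w hw
        have hwB := Finset.mem_of_mem_erase hw
        have := hmin w hwB
        rcases Finset.mem_insert.1 hu with rfl | hu
        · omega
        · have := hAB u hu w hwB
          omega
      · intro w hw
        have := hB w (Finset.mem_of_mem_erase hw)
        omega
    obtain ⟨M, hM, hreach⟩ := hmain
    refine ⟨M + b * R, by nlinarith, canReach_slide (a := a) (b * R) hxv (by omega) ?_ hreach⟩
    intro u hu huv
    rcases (hx u).1 hu with h | h
    · have := hAB u h v hvB
      left; omega
    · exact Or.inr (hmin u h)

lemma exists_le_height (i : Fin d) (S : Finset (Fin d → ZMod m)) {g : ℕ} (hg : S.card * g < m) :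
    ∃ a : ZMod m, ∀ v ∈ S, g ≤ height i a v := by
  by_contra! h
  have hsub : (Finset.univ : Finset (ZMod m)) ⊆
      (S ×ˢ Finset.range g).image fun p => p.1 i - (p.2 : ZMod m) := by
    intro a _
    obtain ⟨v, hv, hlt⟩ := h a
    refine Finset.mem_image.2 ⟨(v, height i a v),
      Finset.mem_product.2 ⟨hv, Finset.mem_range.2 hlt⟩, ?_⟩
    simp [height]
  have h1 := (Finset.card_le_card hsub).trans Finset.card_image_le
  rw [Finset.card_univ, ZMod.card, Finset.card_product, Finset.card_range] at h1
  omega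

lemma hitProb_le_of_heightSeparated (hd : d ≠ 0) (hm : 3 ≤ m) {q : ℝ} (hq : 0 ≤ q)
    (hq1 : q * (m : ℝ) ^ d ≤ 1) (T : ℕ) {k R : ℕ} {η : ℝ} (hη : 0 ≤ η)
    (hgreen : ∀ z : Fin d → ZMod m, (∀ t < R, heat t z = 0) → green z ≤ η)
    {i : Fin d} {a : ZMod m} {x : (Fin d → ZMod m) → Bool} (hx : numParticles x = k)
    (hsep : HeightSeparated i a R x) :
    hitProb (torusKernel d m q) (fun y => numParticles y < k) T x ≤
      k * (k * η) + T * (q * (4 * k ^ 2 * ((1 + 2 * √d) ^ d / (m : ℝ) ^ d))) := by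
  refine (hitProb_le_collisionEnergy hd hm hq hq1 T k hx.le).trans (add_le_add ?_ le_rfl)
  have hcard : ((occupied x).card : ℝ) = k := by rw [← hx]; rfl
  rw [collisionEnergy, if_neg (by omega), ← hcard]
  refine pairEnergy_le hη fun u hu v hv huv => hgreen _ fun t ht => ?_
  exact heat_eq_zero_of_heightSeparated hsep (mem_occupied.1 hu) (mem_occupied.1 hv) huv ht

lemma survival_lower_bound (hd : d ≠ 0) (hm : 3 ≤ m) {q : ℝ} (hq : 0 ≤ q)
    (hq1 : q * (m : ℝ) ^ d ≤ 1) {T k R : ℕ} (hT : 1 ≤ T * q) (hk : 1 ≤ k) (hR : 1 ≤ R)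
    (hRm : k * (R + k * R) < m) {η : ℝ} (hη : 0 ≤ η)
    (hgreen : ∀ z : Fin d → ZMod m, (∀ t < R, heat t z = 0) → green z ≤ η)
    (hsmall : k * (k * η) + T * (q * (4 * k ^ 2 * ((1 + 2 * √d) ^ d / (m : ℝ) ^ d))) ≤ 1 / 2)
    {x : (Fin d → ZMod m) → Bool} (hx : numParticles x = k) :
    (1 / (4 * d * k) : ℝ) ^ (k * k * R) * (1 / 2) ≤
      1 - hitProb (torusKernel d m q) (fun y => numParticles y < k) T x := by
  have hcard : (occupied x).card = k := hx
  obtain ⟨a, ha⟩ := exists_le_height (⟨0, Nat.pos_of_ne_zero hd⟩ : Fin d) (occupied x)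
    (g := R + k * R) (by rwa [hcard])
  obtain ⟨M, hM, hreach⟩ := canReach_heightSeparated hR k (A := ∅) (B := occupied x) (x := x)
    hcard (by simp [mem_occupied]) (by simp) (by simp) (by simp) ha
  have hd' : (1 : ℝ) ≤ d := by exact_mod_cast Nat.one_le_iff_ne_zero.2 hd
  have hk' : (1 : ℝ) ≤ k := by exact_mod_cast hk
  refine le_trans ?_ (survival_of_canReach (s := 1 / 2) hd hm hq hq1 hT hk ?_ hx hreach)
  · refine mul_le_mul_of_nonneg_right (pow_le_pow_of_le_one (by positivity) ?_ hM) (by norm_num)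
    rw [div_le_one (by positivity)]
    nlinarith
  · intro y hsep hy
    linarith [hitProb_le_of_heightSeparated hd hm hq hq1 T hη hgreen hy hsep]

end Spreading

/-- Fix `0 < c`, `d ≥ 3` and `K ≥ 2`. There exist `ε > 0` and `δ > 0`
depending only on `c, d, K` such that for all `n = (L+1)^d` sufficiently large, the
coalescence process on `Λ(L+1,d)` with `k` initial particles and moving rate `q = cd/n²`
satisfies `P[τ_col < εn³ | W_0 = w] ≤ 1 − δ` uniformly over all `2 ≤ k ≤ K` and initial
configurations `w ∈ Ω_k`. -/
theorem coalescence_collision_time_lower_bound (c : ℝ) (hc : 0 < c) (d : ℕ) (hd : 3 ≤ d)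
    (K : ℕ) (hK : 2 ≤ K) :
    ∃ ε δ : ℝ, 0 < ε ∧ 0 < δ ∧ ∃ N : ℕ,
      ∀ L : ℕ, N < (L + 1) ^ d →
      ∀ k : ℕ, 2 ≤ k → k ≤ K →
      ∀ w : (Fin d → ZMod (L + 1)) → Bool, w ∈ OmegaK (torusGraph (L + 1) d) k →
        trajProb
            (coalKernel (torusGraph (L + 1) d)
              (c * d / (((L + 1) ^ d : ℕ) : ℝ) ^ 2)) w
            (⌈ε * (((L + 1) ^ d : ℕ) : ℝ) ^ 3⌉₊)
            (fun ω => ∃ t : Fin (⌈ε * (((L + 1) ^ d : ℕ) : ℝ) ^ 3⌉₊ + 1),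
              (t : ℝ) < ε * (((L + 1) ^ d : ℕ) : ℝ) ^ 3 ∧ numParticles (ω t) < k) ≤
          1 - δ := by
  have hd0 : d ≠ 0 := by omega
  have hdR : (1 : ℝ) ≤ d := by exact_mod_cast Nat.one_le_iff_ne_zero.2 hd0
  have hKR : (2 : ℝ) ≤ K := by exact_mod_cast hK
  set C : ℝ := (1 + 2 * √d) ^ d with hC
  have hC0 : 0 < C := by positivity
  obtain ⟨R, hR, hgreen⟩ := exists_green_le hd (η := 1 / (4 * K ^ 2)) (by positivity)
  set ε : ℝ := 1 / (32 * c * d * K ^ 2 * C) with hε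
  have hε0 : 0 < ε := by positivity
  refine ⟨ε, (1 / (4 * d * K) : ℝ) ^ (K * K * R) * (1 / 2), hε0, by positivity,
    ⌈c * d⌉₊ + ⌈1 / (ε * (c * d))⌉₊ + ⌈1 / ε⌉₊ + (K * (R + K * R) + 3) ^ d, ?_⟩
  intro L hL k hk hkK w hw
  have hkR : (2 : ℝ) ≤ k := by exact_mod_cast hk
  have hkKR : (k : ℝ) ≤ K := by exact_mod_cast hkK
  have hLbig : K * (R + K * R) + 3 < L + 1 := lt_of_pow_lt_pow_left₀ d (Nat.zero_le _) (by omega)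
  have hcast : (((L + 1 : ℕ) : ℝ)) ^ d = (((L + 1) ^ d : ℕ) : ℝ) := by push_cast; ring
  have hnN : ∀ {r : ℝ}, ⌈r⌉₊ ≤ (L + 1) ^ d → r ≤ (((L + 1) ^ d : ℕ) : ℝ) := fun h =>
    (Nat.le_ceil _).trans (by exact_mod_cast h)
  have hn1 : c * d ≤ (((L + 1) ^ d : ℕ) : ℝ) := hnN (by omega)
  have hn2 : 1 / (ε * (c * d)) ≤ (((L + 1) ^ d : ℕ) : ℝ) := hnN (by omega)
  have hn3 : 1 / ε ≤ (((L + 1) ^ d : ℕ) : ℝ) := hnN (by omega)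
  have hn4 : (1 : ℝ) ≤ (((L + 1) ^ d : ℕ) : ℝ) := by exact_mod_cast Nat.one_le_pow _ _ (by omega)
  generalize (((L + 1) ^ d : ℕ) : ℝ) = n at *
  have hn0 : 0 < n := by linarith
  rw [div_le_iff₀ (by positivity)] at hn2 hn3
  set T := ⌈ε * n ^ 3⌉₊ with hT
  set q := c * d / n ^ 2 with hq
  have hq0 : 0 ≤ q := by positivity
  have hq1 : q * ((L + 1 : ℕ) : ℝ) ^ d ≤ 1 := by
    rw [hcast, hq, div_mul_eq_mul_div, div_le_one (by positivity), sq]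
    exact mul_le_mul_of_nonneg_right hn1 hn0.le
  have hTq : 1 ≤ T * q := by
    have h1 : ε * n ^ 3 * q ≤ T * q := mul_le_mul_of_nonneg_right (Nat.le_ceil _) hq0
    have h2 : ε * n ^ 3 * q = n * (ε * (c * d)) := by rw [hq]; field_simp
    linarith
  have hTle : (T : ℝ) ≤ 2 * (ε * n ^ 3) := by
    have h1 : (T : ℝ) < ε * n ^ 3 + 1 := Nat.ceil_lt_add_one (by positivity)
    have h2 : n * ε ≤ n ^ 3 * ε := mul_le_mul_of_nonneg_right (le_self_pow₀ hn4 (by norm_num)) hε0.le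
    linarith
  have hkk : (k : ℝ) ^ 2 ≤ K ^ 2 := pow_le_pow_left₀ (by positivity) hkKR 2
  have hsmall : (k : ℝ) * (k * (1 / (4 * K ^ 2))) +
      T * (q * (4 * k ^ 2 * (C / ((L + 1 : ℕ) : ℝ) ^ d))) ≤ 1 / 2 := by
    have h1 : (k : ℝ) * (k * (1 / (4 * K ^ 2))) ≤ 1 / 4 := by
      have : (k : ℝ) * (k * (1 / (4 * K ^ 2))) = k ^ 2 / K ^ 2 * (1 / 4) := by field_simp
      rw [this]
      have := div_le_one_of_le₀ hkk (by positivity)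
      linarith
    have h2 : T * (q * (4 * k ^ 2 * (C / ((L + 1 : ℕ) : ℝ) ^ d))) ≤ 1 / 4 := by
      calc T * (q * (4 * k ^ 2 * (C / ((L + 1 : ℕ) : ℝ) ^ d)))
          ≤ 2 * (ε * n ^ 3) * (q * (4 * K ^ 2 * (C / n))) := by rw [hcast]; gcongr
        _ = 1 / 4 := by rw [hε, hq]; field_simp; norm_num
    linarith
  have hsurv := survival_lower_bound hd0 (by omega) hq0 hq1 hTq (by omega) hR
    (lt_of_le_of_lt (by gcongr) (by omega : K * (R + K * R) < L + 1)) (by positivity)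
    (hgreen (L + 1)) hsmall hw.1
  have hδ : (1 / (4 * d * K) : ℝ) ^ (K * K * R) ≤ (1 / (4 * d * k)) ^ (k * k * R) := by
    have h1 : (1 / (4 * d * K) : ℝ) ≤ 1 := by
      rw [div_le_one (by positivity)]
      nlinarith
    calc (1 / (4 * d * K) : ℝ) ^ (K * K * R) ≤ (1 / (4 * d * K)) ^ (k * k * R) :=
          pow_le_pow_of_le_one (by positivity) h1 (by gcongr)
      _ ≤ _ := by gcongr
  have hnonneg := torusKernel_nonneg (d := d) (m := L + 1) hq0 hq1
  have hhit := trajProb_exists_le_hitProb hnonneg (sum_torusKernel hd0 (by omega) q)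
    (fun y => numParticles y < k) w T
  have hmono := trajProb_mono hnonneg w T
    (A := fun ω => ∃ t : Fin (T + 1), (t : ℝ) < ε * n ^ 3 ∧ numParticles (ω t) < k)
    (A' := fun ω => ∃ t : Fin (T + 1), numParticles (ω t) < k)
    fun ω ⟨t, _, ht⟩ => ⟨t, ht⟩
  refine hmono.trans (hhit.trans ?_)
  linarith
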